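/- arXiv:1208.5177 — 3 statements merged into one kernel-verified Lean document; each statement's English description precedes it below -/
import Mathlib

section
/- In MvPolynomial (Fin 2) ℚ the following polynomial identity holds: (197/4)·h⁶ + (104 − (363/2)·P)·h⁵ + (63 − 421·P + (825/4)·P²)·h⁴ + (−306·P + 510·P² − 75·P³)·h³ + (−Q + 412·P² − 195·P³)·h² + (2·P·Q − 170·P³)·h − P²·Q = 0. -/
noncomputable section

abbrev R2Q : Type := MvPolynomial (Fin 2) ℚ

def x : R2Q := MvPolynomial.X 0
def y : R2Q := MvPolynomial.X 1
def t : R2Q := x * y - 1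
def h : R2Q := t * (x * t + 1)
def f : R2Q := (x * t + 1) ^ 2 * (t ^ 2 + y)
def P : R2Q := f + h
def q : R2Q := -t ^ 2 - 6 * t * h * (h + 1)
def u : R2Q :=
  170 * f * h + 91 * h ^ 2 + 195 * f * h ^ 2 + 69 * h ^ 3 + 75 * f * h ^ 3 +
    MvPolynomial.C (75 / 4 : ℚ) * h ^ 4
def Q : R2Q := q - u

/-- The algebraic relation between `f`, `h` and `t`. -/
theorem f_mul_h_sub_t : f * (h - t) = h ^ 2 * (h + 1) := by
  simp only [f, h, t]
  ring

/-- The polynomial relation `R(h) = 0` satisfied by `h` over `ℚ[P,Q]`. -/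
theorem pinchuk_R_relation :
    MvPolynomial.C (197 / 4 : ℚ) * h ^ 6 +
      (104 - MvPolynomial.C (363 / 2 : ℚ) * P) * h ^ 5 +
      (63 - 421 * P + MvPolynomial.C (825 / 4 : ℚ) * P ^ 2) * h ^ 4 +
      (-306 * P + 510 * P ^ 2 - 75 * P ^ 3) * h ^ 3 +
      (-Q + 412 * P ^ 2 - 195 * P ^ 3) * h ^ 2 +
      (2 * P * Q - 170 * P ^ 3) * h - P ^ 2 * Q = 0 := by
  have hC (n : ℕ) : (MvPolynomial.C (n / 4 : ℚ) : R2Q) =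
      (n : R2Q) * MvPolynomial.C (1 / 4 : ℚ) := by
    rw [← map_natCast MvPolynomial.C, ← map_mul]
    ring_nf
  have h197 := hC 197
  have h726 := hC 726
  have h825 := hC 825
  have h75 := hC 75
  have h4 : (4 : R2Q) * MvPolynomial.C (1 / 4 : ℚ) = 1 := by
    simpa using (hC 4).symm
  push_cast at h197 h726 h825 h75
  rw [show (363 / 2 : ℚ) = 726 / 4 by norm_num, h197, h726, h825]
  simp only [P, Q, q, u, h75]
  linear_combination
    -(f * t + f * h - h ^ 2 * (h + 1) + 6 * f * h * (h + 1)) * f_mul_h_sub_t +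
      (74 * h ^ 6 + 231 * h ^ 5 * f + 225 * h ^ 4 * f ^ 2) * h4
end
end

section
/- Let q₀(T) = (197/4)T⁴ + 104T³ + 63T² ∈ ℝ[T]. Suppose φ ∈ RatFunc ℝ is a real rational function in one variable such that for infinitely many real numbers s, φ is defined at s (the denominator of φ does not vanish at s) and q₀(φ(s)) = q₀(s). Then φ = X, the identity rational function. -/
noncomputable section

/-- The polynomial `q₀(T) = (197/4)T⁴ + 104T³ + 63T²`. -/
def q₀ : Polynomial ℝ :=
  Polynomial.C (197 / 4) * Polynomial.X ^ 4 + Polynomial.C 104 * Polynomial.X ^ 3 +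
    Polynomial.C 63 * Polynomial.X ^ 2

/-- A real polynomial that preserves `q₀` under composition is the identity. -/
theorem eq_X_of_q₀_comp_eq {p : Polynomial ℝ} (h : q₀.comp p = q₀) : p = Polynomial.X := by
  have hdeg : q₀.natDegree = 4 := by
    unfold q₀
    compute_degree!
  have hp : p.natDegree ≤ 1 := by
    have := congrArg Polynomial.natDegree h
    rw [Polynomial.natDegree_comp, hdeg] at this
    omega
  obtain ⟨a, b, rfl⟩ := Polynomial.exists_eq_X_add_C_of_natDegree_le_one hp
  have he (s : ℝ) := congrArg (Polynomial.eval s) h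
  simp only [q₀, Polynomial.eval_comp, Polynomial.eval_add, Polynomial.eval_mul,
    Polynomial.eval_pow, Polynomial.eval_C, Polynomial.eval_X] at he
  have hb : b = 0 := by
    have hpos : 0 < 197 / 4 * b ^ 2 + 104 * b + 63 := by
      nlinarith [sq_nonneg (197 * b + 208)]
    have hmul : b ^ 2 * (197 / 4 * b ^ 2 + 104 * b + 63) = 0 := by linear_combination he 0
    exact pow_eq_zero_iff two_ne_zero |>.1 ((mul_eq_zero.1 hmul).resolve_right hpos.ne')
  subst hb
  have ha : a = 1 := by
    have hcube : (a - 1) * (a ^ 2 + a + 1) = 0 := by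
      linear_combination (he 1 - he (-1)) / 208
    have hpos : 0 < a ^ 2 + a + 1 := by nlinarith [sq_nonneg (2 * a + 1)]
    exact sub_eq_zero.1 ((mul_eq_zero.1 hcube).resolve_right hpos.ne')
  simp [ha]

/-- If a real rational function `φ` satisfies `q₀(φ(s)) = q₀(s)` for infinitely many
real `s` at which it is defined, then `φ` is the identity. -/
theorem ratfunc_q0_rigidity (φ : RatFunc ℝ)
    (hinf : {s : ℝ | Polynomial.eval s φ.denom ≠ 0 ∧
        Polynomial.eval (φ.eval (RingHom.id ℝ) s) q₀ = Polynomial.eval s q₀}.Infinite) :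
    φ = RatFunc.X := by
  have hpoly : Polynomial.C (197 / 4) * φ.num ^ 4 + Polynomial.C 104 * φ.num ^ 3 * φ.denom +
      Polynomial.C 63 * φ.num ^ 2 * φ.denom ^ 2 = q₀ * φ.denom ^ 4 := by
    refine Polynomial.eq_of_infinite_eval_eq _ _ (hinf.mono ?_)
    rintro s ⟨hs, h⟩
    simp only [q₀, RatFunc.eval, Polynomial.eval₂_id, Polynomial.eval_add, Polynomial.eval_mul,
      Polynomial.eval_pow, Polynomial.eval_C, Polynomial.eval_X] at h
    simp only [q₀, Set.mem_ofPred_eq, Polynomial.eval_add, Polynomial.eval_mul,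
      Polynomial.eval_pow, Polynomial.eval_C, Polynomial.eval_X]
    rw [← h]
    field_simp
  have hdvd : φ.denom ∣ φ.num ^ 4 := by
    have hC : (Polynomial.C (4 / 197) * Polynomial.C (197 / 4) : Polynomial ℝ) = 1 := by
      rw [← Polynomial.C_mul]
      norm_num
    refine ⟨Polynomial.C (4 / 197) * (q₀ * φ.denom ^ 3 - Polynomial.C 104 * φ.num ^ 3 -
      Polynomial.C 63 * φ.num ^ 2 * φ.denom), ?_⟩
    linear_combination Polynomial.C (4 / 197) * hpoly - φ.num ^ 4 * hC
  have hdenom : φ.denom = 1 :=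
    φ.monic_denom.eq_one_of_isUnit
      ((φ.isCoprime_num_denom.symm.pow_right (n := 4)).isUnit_of_dvd' dvd_rfl hdvd)
  have hnum : φ.num = Polynomial.X := by
    refine eq_X_of_q₀_comp_eq ?_
    simpa [hdenom, q₀] using hpoly
  rw [← φ.num_div_denom, hnum, hdenom, map_one, div_one, RatFunc.algebraMap_X]
end
end

section
/- Let k be a subfield of ℝ, and let P_k, Q_k ∈ MvPolynomial (Fin 2) k be obtained from the rational-coefficient polynomials P and Q by mapping their coefficients into k. Let S ∈ Polynomial k be arbitrary, and set Q' = Q_k + Polynomial.aeval P_k S (so that (P_k, Q') represents an arbitrary Pinchuk map defined over k). Let L = FractionRing (MvPolynomial (Fin 2) k), identify polynomials with their images in L, and let E_k = k⟮P_k, Q'⟯ ⊆ L be the intermediate field of L over k generated by P_k and Q'. Then Module.finrank E_k L = 6, and every automorphism σ : L ≃ₐ[E_k] L is the identity. -/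
noncomputable section

/-- `P` with coefficients mapped into the subfield `k` of `ℝ`. -/
def Pk (k : Subfield ℝ) : MvPolynomial (Fin 2) ↥k :=
  MvPolynomial.map (algebraMap ℚ ↥k) P

/-- `Q` with coefficients mapped into the subfield `k` of `ℝ`. -/
def Qk (k : Subfield ℝ) : MvPolynomial (Fin 2) ↥k :=
  MvPolynomial.map (algebraMap ℚ ↥k) Q

/-- The second component of an arbitrary Pinchuk map defined over `k`. -/
def Q' (k : Subfield ℝ) (S : Polynomial ↥k) : MvPolynomial (Fin 2) ↥k :=
  Qk k + Polynomial.aeval (Pk k) S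

/-- The rational function field `L = k(x,y)`. -/
abbrev Lk (k : Subfield ℝ) : Type := FractionRing (MvPolynomial (Fin 2) ↥k)

/-- `E_k = k(P_k, Q')`, the intermediate field of `L` over `k` generated by the two
components of the Pinchuk map. -/
def Ek (k : Subfield ℝ) (S : Polynomial ↥k) : IntermediateField ↥k (Lk k) :=
  IntermediateField.adjoin ↥k
    ({algebraMap (MvPolynomial (Fin 2) ↥k) (Lk k) (Pk k),
      algebraMap (MvPolynomial (Fin 2) ↥k) (Lk k) (Q' k S)} : Set (Lk k))


section Sextic

open Polynomial

variable {K : Type*} [Field K]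

/-- The polynomial `∑ aᵢ Xⁱ` of degree at most six with the given coefficients. -/
def sextic (a : Fin 7 → K) : K[X] :=
  C (a 6) * X ^ 6 + C (a 5) * X ^ 5 + C (a 4) * X ^ 4 + C (a 3) * X ^ 3 + C (a 2) * X ^ 2 +
    C (a 1) * X + C (a 0)

theorem natDegree_sextic {a : Fin 7 → K} (ha : a 6 ≠ 0) : (sextic a).natDegree = 6 := by
  unfold sextic
  compute_degree!

theorem isCoprime_C_left {c : K} (hc : c ≠ 0) (p : K[X]) : IsCoprime (C c) p :=
  ⟨C c⁻¹, 0, by rw [← C_mul, inv_mul_cancel₀ hc]; simp⟩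

theorem isCoprime_sextic_X_sq {a : Fin 7 → K} (ha : a 0 ≠ 0) :
    IsCoprime (sextic a) (X ^ 2) := by
  refine IsCoprime.pow_right ?_
  have h0 : IsCoprime (C (a 0)) (X : K[X]) :=
    isCoprime_C_left ha X
  have : sextic a = C (a 0) + X * (C (a 6) * X ^ 5 + C (a 5) * X ^ 4 + C (a 4) * X ^ 3 +
      C (a 3) * X ^ 2 + C (a 2) * X + C (a 1)) := by
    unfold sextic; ring
  rw [this]
  exact IsCoprime.add_mul_left_left h0 _

/-- A rational function `G / X ^ 2` with `G` of degree six and `G(0) ≠ 0` has degree six. -/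
theorem finrank_adjoin_of_mul_X_sq_eq_sextic {a : Fin 7 → K} (h0 : a 0 ≠ 0) (h6 : a 6 ≠ 0)
    {c : RatFunc K} (hc : c * RatFunc.X ^ 2 = algebraMap K[X] (RatFunc K) (sextic a)) :
    Module.finrank (IntermediateField.adjoin K {c}) (RatFunc K) = 6 := by
  have hX : (X ^ 2 : K[X]) ≠ 0 := pow_ne_zero _ X_ne_zero
  have hG : sextic a ≠ 0 := by
    intro h
    simpa [h] using natDegree_sextic h6
  have hc' : c = algebraMap K[X] (RatFunc K) (sextic a) / algebraMap K[X] (RatFunc K) (X ^ 2) := by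
    rw [← hc, map_pow, RatFunc.algebraMap_X, mul_div_cancel_right₀]
    exact pow_ne_zero _ RatFunc.X_ne_zero
  have hnum : c.num ∣ sextic a := hc' ▸ RatFunc.num_div_dvd _ hX
  have hden : c.denom ∣ X ^ 2 := hc' ▸ RatFunc.denom_div_dvd _ _
  have hnum' : sextic a ∣ c.num := by
    refine (isCoprime_sextic_X_sq h0).dvd_of_dvd_mul_right ⟨c.denom, ?_⟩
    apply RatFunc.algebraMap_injective K
    have hd : algebraMap K[X] (RatFunc K) c.denom ≠ 0 :=
      RatFunc.algebraMap_ne_zero c.denom_ne_zero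
    rw [map_mul, map_mul, ← hc, map_pow, RatFunc.algebraMap_X, mul_right_comm,
      (eq_div_iff hd).1 (RatFunc.num_div_denom c).symm]
  have hne : c.num ≠ 0 := ne_zero_of_dvd_ne_zero hG hnum
  have h1 := natDegree_le_of_dvd hnum hG
  have h2 := natDegree_le_of_dvd hnum' hne
  have h3 := natDegree_le_of_dvd hden hX
  rw [natDegree_sextic h6] at h1 h2
  rw [natDegree_X_pow] at h3
  rw [RatFunc.finrank_eq_max_natDegree]
  omega

theorem eq_X_of_sextic_comp_linear {a : Fin 7 → K} (h0 : a 0 ≠ 0) (h1 : a 1 ≠ 0) {b c : K}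
    (h : (sextic a).comp (C b * X + C c) * X ^ 2 = sextic a * (C b * X + C c) ^ 2) :
    b = 1 ∧ c = 0 := by
  have hc : c = 0 := by
    have := congrArg (eval 0) h
    simpa [sextic, h0] using this
  subst hc
  have hX : (X ^ 2 : K[X]) ≠ 0 := pow_ne_zero _ X_ne_zero
  have h' : (sextic a).comp (C b * X) = sextic a * C (b ^ 2) := by
    apply mul_right_cancel₀ hX
    simp only [map_zero, add_zero] at h
    rw [h, C_pow]
    ring
  have e0 := congrArg (fun p => coeff p 0) h'
  have e1 := congrArg (fun p => coeff p 1) h'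
  simp only [comp_C_mul_X_coeff, coeff_mul_C] at e0 e1
  have c0 : (sextic a).coeff 0 = a 0 := by simp [sextic, coeff_X, coeff_C]
  have c1 : (sextic a).coeff 1 = a 1 := by simp [sextic, coeff_C, coeff_X_pow]
  rw [c0, pow_zero] at e0
  rw [c1, pow_one] at e1
  have hb2 : 1 = b ^ 2 := mul_left_cancel₀ h0 e0
  rw [← hb2] at e1
  exact ⟨mul_left_cancel₀ h1 e1, rfl⟩

/-- `X` is the only solution `v` in `K(X)` of `G(v) / v ^ 2 = G(X) / X ^ 2`, where `G` has degree
six and nonzero coefficients in degrees zero and one. -/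
theorem eq_X_of_sextic_eq {a : Fin 7 → K} (h0 : a 0 ≠ 0) (h1 : a 1 ≠ 0) (h6 : a 6 ≠ 0)
    {v : RatFunc K}
    (hv : aeval v (sextic a) * RatFunc.X ^ 2 = algebraMap K[X] (RatFunc K) (sextic a) * v ^ 2) :
    v = RatFunc.X := by
  set m := v.num
  set n := v.denom
  have hn : n ≠ 0 := v.denom_ne_zero
  have hn' : algebraMap K[X] (RatFunc K) n ≠ 0 := RatFunc.algebraMap_ne_zero hn
  have hvmn : v = algebraMap K[X] (RatFunc K) m / algebraMap K[X] (RatFunc K) n :=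
    (RatFunc.num_div_denom v).symm
  have hmn : IsCoprime m n := v.isCoprime_num_denom
  have hG : sextic a ≠ 0 := by
    intro h
    simpa [h] using natDegree_sextic h6
  obtain ⟨F, hF⟩ : ∃ F, F = C (a 6) * m ^ 6 + C (a 5) * m ^ 5 * n + C (a 4) * m ^ 4 * n ^ 2 +
    C (a 3) * m ^ 3 * n ^ 3 + C (a 2) * m ^ 2 * n ^ 4 + C (a 1) * m * n ^ 5 + C (a 0) * n ^ 6 :=
    ⟨_, rfl⟩
  have key : F * X ^ 2 = sextic a * (m ^ 2 * n ^ 4) := by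
    apply RatFunc.algebraMap_injective K
    have hC : ∀ r : K, algebraMap K[X] (RatFunc K) (C r) = algebraMap K (RatFunc K) r :=
      fun r => by simp
    have hG' : aeval v (sextic a) = algebraMap K (RatFunc K) (a 6) * v ^ 6 +
        algebraMap K (RatFunc K) (a 5) * v ^ 5 + algebraMap K (RatFunc K) (a 4) * v ^ 4 +
        algebraMap K (RatFunc K) (a 3) * v ^ 3 + algebraMap K (RatFunc K) (a 2) * v ^ 2 +
        algebraMap K (RatFunc K) (a 1) * v + algebraMap K (RatFunc K) (a 0) := by
      simp only [sextic, map_add, map_mul, map_pow, aeval_X, aeval_C]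
    rw [hG', hvmn] at hv
    simp only [hF, map_add, map_mul, map_pow, RatFunc.algebraMap_X, hC]
    field_simp at hv
    linear_combination hv
  have hFn : IsCoprime F n := by
    have : F = C (a 6) * m ^ 6 + n * (C (a 5) * m ^ 5 + C (a 4) * m ^ 4 * n +
      C (a 3) * m ^ 3 * n ^ 2 + C (a 2) * m ^ 2 * n ^ 3 + C (a 1) * m * n ^ 4 +
      C (a 0) * n ^ 5) := by rw [hF]; ring
    rw [this]
    exact IsCoprime.add_mul_left_left
      ((isCoprime_C_left h6 _).mul_left hmn.pow_left) _
  have hFm : IsCoprime F m := by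
    have : F = C (a 0) * n ^ 6 + m * (C (a 6) * m ^ 5 + C (a 5) * m ^ 4 * n +
      C (a 4) * m ^ 3 * n ^ 2 + C (a 3) * m ^ 2 * n ^ 3 + C (a 2) * m * n ^ 4 +
      C (a 1) * n ^ 5) := by rw [hF]; ring
    rw [this]
    exact IsCoprime.add_mul_left_left
      ((isCoprime_C_left h0 _).mul_left hmn.symm.pow_left) _
  have hX : (X ^ 2 : K[X]) ≠ 0 := pow_ne_zero _ X_ne_zero
  have hdvd : m ^ 2 * n ^ 4 ∣ X ^ 2 :=
    (hFm.symm.pow_left.mul_left hFn.symm.pow_left).dvd_of_dvd_mul_left ⟨sextic a, by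
      rw [key, mul_comm]⟩
  have hm : m ≠ 0 := by
    intro h
    rw [h] at hdvd
    simp at hdvd
  have hdeg := natDegree_le_of_dvd hdvd hX
  rw [natDegree_mul (pow_ne_zero _ hm) (pow_ne_zero _ hn), natDegree_pow, natDegree_pow,
    natDegree_X_pow] at hdeg
  have hn1 : n = 1 := v.monic_denom.natDegree_eq_zero.1 (show n.natDegree = 0 by omega)
  obtain ⟨b, c, hbc⟩ := exists_eq_X_add_C_of_natDegree_le_one (p := m) (by omega)
  have hlin : (sextic a).comp (C b * X + C c) * X ^ 2 = sextic a * (C b * X + C c) ^ 2 := by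
    rw [hn1, hbc] at key hF
    rw [one_pow, mul_one] at key
    rw [← key, hF]
    simp [sextic]
  obtain ⟨rfl, rfl⟩ := eq_X_of_sextic_comp_linear h0 h1 hlin
  rw [hvmn, hn1, hbc]
  simp

/-- If `L = K(f)` with `f` transcendental and `c = G(f) / f ^ 2`, where `G` has degree six and
nonzero coefficients in degrees zero and one, then `L` has degree six over `K(c)`, and the only
automorphism of `L` over `K(c)` is the identity. -/
theorem finrank_adjoin_eq_six_and_algEquiv_eq_refl {L : Type*} [Field L] [Algebra K L] {f c : L}
    (hf : Transcendental K f) (htop : IntermediateField.adjoin K {f} = ⊤) {a : Fin 7 → K}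
    (h0 : a 0 ≠ 0) (h1 : a 1 ≠ 0) (h6 : a 6 ≠ 0) (hc : c * f ^ 2 = aeval f (sextic a)) :
    Module.finrank (IntermediateField.adjoin K {c}) L = 6 ∧
      ∀ σ : L ≃ₐ[IntermediateField.adjoin K {c}] L, σ = AlgEquiv.refl := by
  let e : RatFunc K ≃ₐ[K] L := (RatFunc.algEquivOfTranscendental f hf).trans
    ((IntermediateField.equivOfEq htop).trans IntermediateField.topEquiv)
  have eX : e RatFunc.X = f := RatFunc.algEquivOfTranscendental_X f hf
  have eG : e (algebraMap K[X] (RatFunc K) (sextic a)) = aeval f (sextic a) := by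
    rw [← RatFunc.aeval_X_left_eq_algebraMap, ← eX]
    exact (aeval_algHom_apply (e : RatFunc K →ₐ[K] L) _ _).symm
  obtain ⟨d, rfl⟩ := e.surjective c
  have hd : d * RatFunc.X ^ 2 = algebraMap K[X] (RatFunc K) (sextic a) := by
    apply e.injective
    rw [eG, ← hc, map_mul, map_pow, eX]
  constructor
  · rw [← finrank_adjoin_of_mul_X_sq_eq_sextic h0 h6 hd]
    have hmap : (IntermediateField.adjoin K {d}).map (e : RatFunc K →ₐ[K] L) =
        IntermediateField.adjoin K {e d} := by
      rw [IntermediateField.adjoin_map, Set.image_singleton]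
      rfl
    rw [← hmap]
    exact (Algebra.finrank_eq_of_equiv_equiv
      (IntermediateField.intermediateFieldMap e (IntermediateField.adjoin K {d})).toRingEquiv
      e.toRingEquiv rfl).symm
  · intro σ
    have hσc : σ (e d) = e d :=
      σ.commutes ⟨e d, IntermediateField.mem_adjoin_simple_self K (e d)⟩
    let τ : L ≃ₐ[K] L := σ.restrictScalars K
    have hσf : e.symm (τ f) = RatFunc.X := by
      apply eq_X_of_sextic_eq h0 h1 h6
      apply e.injective
      have h2 : e (aeval (e.symm (τ f)) (sextic a)) = aeval (τ f) (sextic a) := by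
        rw [← e.apply_symm_apply (τ f)]
        simpa using (aeval_algHom_apply (e : RatFunc K →ₐ[K] L) (e.symm (τ f)) (sextic a)).symm
      have h3 : aeval (τ f) (sextic a) = e d * τ f ^ 2 := by
        rw [← hσc]
        change _ = τ (e d) * τ f ^ 2
        rw [← map_pow, ← map_mul, hc]
        exact aeval_algHom_apply (τ : L →ₐ[K] L) f (sextic a)
      rw [map_mul, map_pow, h2, eX, map_mul, map_pow, eG, e.apply_symm_apply, ← hc, h3]
      ring
    have hτf : τ f = f := (e.symm_apply_eq.1 hσf).trans eX
    ext z
    change τ z = z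
    have hz : z ∈ IntermediateField.adjoin K {f} := htop ▸ IntermediateField.mem_top
    induction hz using IntermediateField.adjoin_induction with
    | mem w hw => rw [Set.mem_singleton_iff.1 hw, hτf]
    | algebraMap r => exact τ.commutes r
    | add w z _ _ hw hz => rw [map_add, hw, hz]
    | inv w _ hw => rw [map_inv₀, hw]
    | mul w z _ _ hw hz => rw [map_mul, hw, hz]

end Sextic

section PinchukExtension

open IntermediateField

variable {k L : Type*} [Field k] [Field L] [Algebra k L]

theorem algebraicIndependent_pair_of_adjoin_eq_top {a b : L} (htr : 2 ≤ Algebra.trdeg k L)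
    (htop : adjoin k {a, b} = ⊤) : AlgebraicIndependent k ![a, b] := by
  have htop' : adjoin k (Set.range ![a, b]) = ⊤ := by
    rw [Matrix.range_cons_cons_empty, htop]
  have : Algebra.IsAlgebraic (Algebra.adjoin k (Set.range ![a, b])) L := by
    rw [← isAlgebraic_adjoin_iff_top, htop']
    exact ⟨fun z => isAlgebraic_algebraMap (⟨z, mem_top⟩ : (⊤ : IntermediateField k L))⟩
  refine (Algebra.IsAlgebraic.isTranscendenceBasis_of_lift_le_trdeg_of_finite k _ ?_).1
  simpa using htr

/-- The coefficients of `(Q + S(P)) * f ^ 2` as a polynomial in `f` over `k(P)`, where `p = P`,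
`s = S(P)` and `w = 75 / 4`. -/
def pinchukCoeff {K : Type*} [Field K] (w p s : K) : Fin 7 → K :=
  ![-(p ^ 4 * (p + 1) ^ 2), 12 * p ^ 3 * (p + 1) ^ 2,
    -(45 + w) * p ^ 4 - 151 * p ^ 3 - 128 * p ^ 2 + s,
    (5 + 4 * w) * p ^ 3 + 134 * p ^ 2 + 54 * p,
    (150 - 6 * w) * p ^ 2 + 99 * p + 63,
    -(189 - 4 * w) * p - 104, 68 - w]

theorem finrank_adjoin_pair_eq_six_and_algEquiv_eq_refl [CharZero k] {P f c : L} {w : k}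
    (hw : 68 - w ≠ 0) (S : Polynomial k) (hind : AlgebraicIndependent k ![P, f]) (htop : adjoin k {P, f} = ⊤)
    (hc : c * f ^ 2 = Polynomial.aeval f
      (sextic (pinchukCoeff (algebraMap k L w) P (Polynomial.aeval P S)))) :
    Module.finrank (adjoin k {P, c}) L = 6 ∧
      ∀ σ : L ≃ₐ[adjoin k {P, c}] L, σ = AlgEquiv.refl := by
  have htr : Transcendental (adjoin k {P}) f := by
    rw [transcendental_adjoin_iff]
    have := hind.transcendental_adjoin (s := {0}) (i := 1) (by simp)
    rwa [Set.image_singleton] at this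
  have htop' : adjoin (adjoin k {P}) {f} = ⊤ := by
    apply restrictScalars_injective k
    rw [adjoin_adjoin_left, Set.singleton_union, htop, restrictScalars_top]
  have hP : Transcendental k P := hind.transcendental 0
  let K := adjoin k {P}
  let p : K := AdjoinSimple.gen k P
  have hp : algebraMap K L p = P := rfl
  have hp0 : p ≠ 0 := fun h0 => hP (by
    rw [← hp, h0, map_zero]
    exact isAlgebraic_zero)
  have hp1 : p + 1 ≠ 0 := fun h0 => hP (by
    rw [← hp, eq_neg_of_add_eq_zero_left h0, map_neg, map_one]
    exact isAlgebraic_one.neg)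
  have hK : CharZero K := charZero_of_injective_algebraMap (algebraMap k K).injective
  have hw' : algebraMap K L (algebraMap k K w) = algebraMap k L w := rfl
  have hS : algebraMap K L (Polynomial.aeval p S) = Polynomial.aeval P S := by
    rw [← Polynomial.aeval_algebraMap_apply, hp]
  rw [← Set.singleton_union, ← adjoin_adjoin_left]
  refine finrank_adjoin_eq_six_and_algEquiv_eq_refl (K := K) htr htop'
    (a := pinchukCoeff (algebraMap k K w) p (Polynomial.aeval p S)) ?_ ?_ ?_ ?_
  · exact neg_ne_zero.2 (mul_ne_zero (pow_ne_zero _ hp0) (pow_ne_zero _ hp1))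
  · exact mul_ne_zero (mul_ne_zero (by norm_num) (pow_ne_zero _ hp0)) (pow_ne_zero _ hp1)
  · have := (map_ne_zero (algebraMap k K)).2 hw
    rwa [map_sub, map_ofNat] at this
  · rw [hc]
    simp only [sextic, pinchukCoeff, Matrix.cons_val, map_add, map_sub, map_mul, map_pow, map_neg,
      map_ofNat, map_one, Polynomial.aeval_C, Polynomial.aeval_X, hp, hw', hS,
      Algebra.algebraMap_self_apply]

end PinchukExtension

section PinchukIdentities

theorem t_mul_f : t * f = h * f - h ^ 2 * (h + 1) := by
  unfold f h t
  ring

theorem x_mul_t_sq : x * t ^ 2 = h - t := by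
  unfold h
  ring

theorem x_mul_y : x * y = t + 1 := by
  unfold t
  ring

theorem Q_mul_f_sq :
    Q * f ^ 2 = (68 - MvPolynomial.C (75 / 4)) * f ^ 6 +
      (-(189 - 4 * MvPolynomial.C (75 / 4)) * P - 104) * f ^ 5 +
      ((150 - 6 * MvPolynomial.C (75 / 4)) * P ^ 2 + 99 * P + 63) * f ^ 4 +
      ((5 + 4 * MvPolynomial.C (75 / 4)) * P ^ 3 + 134 * P ^ 2 + 54 * P) * f ^ 3 +
      (-(45 + MvPolynomial.C (75 / 4)) * P ^ 4 - 151 * P ^ 3 - 128 * P ^ 2) * f ^ 2 +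
      12 * P ^ 3 * (P + 1) ^ 2 * f - P ^ 4 * (P + 1) ^ 2 := by
  unfold Q q u P
  linear_combination
    (-(t * f + h * f - h ^ 2 * (h + 1)) - 6 * h * (h + 1) * f) * t_mul_f

theorem ne_zero_of_eval_one_two {p : R2Q} (hp : MvPolynomial.eval ![1, 2] p ≠ 0) : p ≠ 0 := by
  rintro rfl
  exact hp (map_zero _)

theorem x_ne_zero : x ≠ 0 := MvPolynomial.X_ne_zero 0

theorem t_ne_zero : t ≠ 0 :=
  ne_zero_of_eval_one_two (by norm_num [t, x, y])

theorem f_ne_zero : f ≠ 0 :=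
  ne_zero_of_eval_one_two (by norm_num [f, t, x, y])

end PinchukIdentities

section PinchukField

open IntermediateField

variable (k : Subfield ℝ)

/-- The embedding of `ℚ[x, y]` into `k(x, y)`. -/
def toLk : R2Q →+* Lk k :=
  (algebraMap (MvPolynomial (Fin 2) k) (Lk k)).comp (MvPolynomial.map (algebraMap ℚ k))

theorem toLk_injective : Function.Injective (toLk k) :=
  (IsFractionRing.injective (MvPolynomial (Fin 2) k) (Lk k)).comp
    (MvPolynomial.map_injective _ (algebraMap ℚ k).injective)

theorem toLk_ne_zero {p : R2Q} (hp : p ≠ 0) : toLk k p ≠ 0 :=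
  (map_ne_zero_iff _ (toLk_injective k)).2 hp

theorem toLk_C (r : ℚ) : toLk k (MvPolynomial.C r) = algebraMap k (Lk k) (algebraMap ℚ k r) := by
  rw [toLk, RingHom.comp_apply, MvPolynomial.map_C]
  rfl

theorem adjoin_eq_top_of_x_mem_of_y_mem {E : IntermediateField k (Lk k)} (hx : toLk k x ∈ E)
    (hy : toLk k y ∈ E) : E = ⊤ := by
  have hpoly : ∀ p : MvPolynomial (Fin 2) k, algebraMap _ (Lk k) p ∈ E := by
    intro p
    induction p using MvPolynomial.induction_on with
    | C r => exact E.algebraMap_mem r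
    | add p q hp hq => rw [map_add]; exact E.add_mem hp hq
    | mul_X p i hp =>
      rw [map_mul]
      refine E.mul_mem hp ?_
      fin_cases i
      · simpa [toLk, x] using hx
      · simpa [toLk, y] using hy
  rw [eq_top_iff]
  intro z _
  obtain ⟨a, b, _, rfl⟩ := IsFractionRing.div_surjective (MvPolynomial (Fin 2) k) z
  exact E.div_mem (hpoly a) (hpoly b)

/-- The functions `P` and `f` generate the field `k(x, y)`. -/
theorem adjoin_P_f_eq_top : adjoin k {toLk k P, toLk k f} = ⊤ := by
  set E := adjoin k {toLk k P, toLk k f}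
  have hP : toLk k P ∈ E := subset_adjoin _ _ (by simp)
  have hf : toLk k f ∈ E := subset_adjoin _ _ (by simp)
  have hh : toLk k h ∈ E := by
    have : toLk k h = toLk k P - toLk k f := by rw [P, map_add]; ring
    exact this ▸ E.sub_mem hP hf
  have ht : toLk k t ∈ E := by
    have : toLk k t = (toLk k h * toLk k f - toLk k h ^ 2 * (toLk k h + 1)) / toLk k f := by
      rw [eq_div_iff (toLk_ne_zero k f_ne_zero), ← map_mul, t_mul_f]
      simp
    rw [this]
    exact E.div_mem (E.sub_mem (E.mul_mem hh hf)
      (E.mul_mem (E.pow_mem hh 2) (E.add_mem hh E.one_mem))) hf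
  have hx : toLk k x ∈ E := by
    have : toLk k x = (toLk k h - toLk k t) / toLk k t ^ 2 := by
      rw [eq_div_iff (pow_ne_zero _ (toLk_ne_zero k t_ne_zero)), ← map_pow, ← map_mul,
        x_mul_t_sq, map_sub]
    exact this ▸ E.div_mem (E.sub_mem hh ht) (E.pow_mem ht 2)
  have hy : toLk k y ∈ E := by
    have : toLk k y = (toLk k t + 1) / toLk k x := by
      rw [eq_div_iff (toLk_ne_zero k x_ne_zero), mul_comm, ← map_mul, x_mul_y, map_add, map_one]
    exact this ▸ E.div_mem (E.add_mem ht E.one_mem) hx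
  exact adjoin_eq_top_of_x_mem_of_y_mem k hx hy

theorem two_le_trdeg_Lk : 2 ≤ Algebra.trdeg k (Lk k) := by
  have hX : AlgebraicIndependent k
      (fun i : Fin 2 => algebraMap (MvPolynomial (Fin 2) k) (Lk k) (MvPolynomial.X i)) :=
    (MvPolynomial.algebraicIndependent_X (Fin 2) k).map'
      (f := IsScalarTower.toAlgHom k (MvPolynomial (Fin 2) k) (Lk k))
      (IsFractionRing.injective (MvPolynomial (Fin 2) k) (Lk k))
  simpa using hX.cardinalMk_le_trdeg

theorem algebraicIndependent_P_f : AlgebraicIndependent k ![toLk k P, toLk k f] :=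
  algebraicIndependent_pair_of_adjoin_eq_top (two_le_trdeg_Lk k) (adjoin_P_f_eq_top k)

theorem algebraMap_Q' (S : Polynomial k) :
    algebraMap (MvPolynomial (Fin 2) k) (Lk k) (Q' k S) =
      toLk k Q + Polynomial.aeval (toLk k P) S := by
  rw [Q', map_add, ← Polynomial.aeval_algebraMap_apply]
  rfl

end PinchukField

/-- For any Pinchuk map defined over a subfield `k` of `ℝ`, the associated extension of
rational function fields has degree six and no nontrivial automorphisms. -/
theorem pinchuk_extension (k : Subfield ℝ) (S : Polynomial ↥k) :
    Module.finrank (Ek k S) (Lk k) = 6 ∧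
    ∀ σ : Lk k ≃ₐ[Ek k S] Lk k, σ = AlgEquiv.refl := by
  have hw : (68 : k) - algebraMap ℚ k (75 / 4) ≠ 0 := by
    have := (map_ne_zero (algebraMap ℚ k)).2 (show (68 - 75 / 4 : ℚ) ≠ 0 by norm_num)
    rwa [map_sub, map_ofNat] at this
  have hQ := congrArg (toLk k) Q_mul_f_sq
  simp only [map_add, map_sub, map_mul, map_pow, map_neg, map_ofNat, map_one, toLk_C] at hQ
  rw [Ek, algebraMap_Q']
  refine finrank_adjoin_pair_eq_six_and_algEquiv_eq_refl (P := toLk k P) hw S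
    (algebraicIndependent_P_f k) (adjoin_P_f_eq_top k) ?_
  simp only [sextic, pinchukCoeff, Matrix.cons_val, map_add, map_sub, map_mul, map_pow, map_neg,
    map_ofNat, map_one, Polynomial.aeval_C, Polynomial.aeval_X, Algebra.algebraMap_self_apply]
  linear_combination hQ
end
end
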